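/- Suppose n ≥ 3 and d = 2. Then for all integers i with 1 ≤ i ≤ 5 and all integers q ≥ 2, the Veronese–Koszul complex at (i,q) is exact. (Equivalently, the quadratic Veronese embedding φ_{O(2)} : P^n ↪ P^N satisfies property N_5.) -/

import Mathlib

open TensorProduct

noncomputable section

variable (K : Type*) [Field K]

/-- `S K n e` is the space of homogeneous polynomials of degree `e`
in the `n+1` variables `x_0, …, x_n`. -/
abbrev S (n e : ℕ) : Submodule K (MvPolynomial (Fin (n + 1)) K) :=
  MvPolynomial.homogeneousSubmodule (Fin (n + 1)) K e

/-- The product of a homogeneous polynomial of degree `d` with one of degree `b`,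
viewed as an element of degree `b + d`. -/
def mulSW {n d b : ℕ} (s : S K n d) (w : S K n b) : S K n (b + d) :=
  ⟨(s : MvPolynomial (Fin (n + 1)) K) * (w : MvPolynomial (Fin (n + 1)) K), by
    rw [MvPolynomial.mem_homogeneousSubmodule, Nat.add_comm b d]
    exact ((MvPolynomial.mem_homogeneousSubmodule _ _).1 s.2).mul
      ((MvPolynomial.mem_homogeneousSubmodule _ _).1 w.2)⟩

/-- Identification of spaces of homogeneous polynomials of equal degrees. -/
def scast {n e₁ e₂ : ℕ} (h : e₁ = e₂) : S K n e₁ ≃ₗ[K] S K n e₂ :=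
  LinearEquiv.ofEq _ _ (by rw [h])

/-- The increasing injection `Fin (a-1) → Fin a` omitting `j`. -/
def skipAt {a : ℕ} (j : Fin a) (i : Fin (a - 1)) : Fin a :=
  if (i : ℕ) < (j : ℕ) then ⟨i, by have := i.isLt; omega⟩
  else ⟨(i : ℕ) + 1, by have := i.isLt; omega⟩

/-- The wedge `v 0 ∧ ⋯ ∧ v (a-1)` as an element of the `a`-th exterior power. -/
def wedge {M : Type*} [AddCommGroup M] [Module K M] (a : ℕ) (v : Fin a → M) :
    ⋀[K]^a M :=
  ⟨ExteriorAlgebra.ιMulti K a v, ExteriorAlgebra.ιMulti_range K a ⟨v, rfl⟩⟩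

/-- `IsKoszulMap K n d a b δ` says that `δ : ⋀^a S_d ⊗ S_b → ⋀^{a-1} S_d ⊗ S_{b+d}` is
the Koszul map, i.e. it satisfies
`δ((s_1 ∧ ⋯ ∧ s_a) ⊗ w) = Σ_j (−1)^{j−1} (s_1 ∧ ⋯ ∧ ŝ_j ∧ ⋯ ∧ s_a) ⊗ (s_j·w)`. -/
def IsKoszulMap (n d a b : ℕ)
    (δ : ((⋀[K]^a (S K n d)) ⊗[K] (S K n b)) →ₗ[K]
         ((⋀[K]^(a - 1) (S K n d)) ⊗[K] (S K n (b + d)))) : Prop :=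
  ∀ (s : Fin a → S K n d) (w : S K n b),
    δ (wedge K a s ⊗ₜ[K] w) =
      ∑ j : Fin a, ((-1 : K) ^ (j : ℕ)) •
        ((wedge K (a - 1) fun i => s (skipAt j i)) ⊗ₜ[K] mulSW K (s j) w)

/-- Exactness of the Veronese–Koszul complex at `(i, q)`:
`ker δ_{i,qd} = im δ_{i+1,(q−1)d}` inside `⋀^i S_d ⊗ S_{qd}`. -/
def VKExact (n d i q : ℕ) : Prop :=
  ∀ (h : (q - 1) * d + d = q * d)
    (δ₁ : ((⋀[K]^i (S K n d)) ⊗[K] (S K n (q * d))) →ₗ[K]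
          ((⋀[K]^(i - 1) (S K n d)) ⊗[K] (S K n (q * d + d))))
    (δ₂ : ((⋀[K]^(i + 1) (S K n d)) ⊗[K] (S K n ((q - 1) * d))) →ₗ[K]
          ((⋀[K]^i (S K n d)) ⊗[K] (S K n ((q - 1) * d + d)))),
    IsKoszulMap K n d i (q * d) δ₁ → IsKoszulMap K n d (i + 1) ((q - 1) * d) δ₂ →
    LinearMap.ker δ₁ =
      LinearMap.range
        ((TensorProduct.congr (LinearEquiv.refl K (⋀[K]^i (S K n d)))
            (scast K h)).toLinearMap ∘ₗ δ₂)

end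

namespace VK
open MvPolynomial

set_option linter.unusedSectionVars false

section Fischer
variable {K : Type*} [Field K] {ι : Type*} [Fintype ι] [DecidableEq ι]

theorem pderiv_comm (i j : ι) (f : MvPolynomial ι K) :
    pderiv i (pderiv j f) = pderiv j (pderiv i f) := by
  have h : ⁅pderiv (R := K) i, pderiv (R := K) j⁆ = 0 := by
    apply MvPolynomial.derivation_ext
    intro k
    rw [Derivation.commutator_apply]
    simp [pderiv_X, Pi.single_apply, apply_ite]
  have h2 := congrArg (fun D => D f) h
  simp only [Derivation.commutator_apply, Derivation.coe_zero, Pi.zero_apply] at h2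
  exact sub_eq_zero.1 h2

/-- product of factorials of exponents -/
noncomputable def fac (α : ι →₀ ℕ) : ℚ := ∏ i, ((α i).factorial : ℚ)

theorem fac_pos (α : ι →₀ ℕ) : 0 < fac α :=
  Finset.prod_pos fun i _ => by exact_mod_cast Nat.factorial_pos _

theorem fac_sub (α : ι →₀ ℕ) (k : ι) (h : α k ≠ 0) :
    fac α = (α k : ℚ) * fac (α - Finsupp.single k 1) := by
  unfold fac
  have h1 := Finset.mul_prod_erase Finset.univ (fun i => ((α i).factorial : ℚ)) (Finset.mem_univ k)
  have h2 := Finset.mul_prod_erase Finset.univ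
    (fun i => (((α - Finsupp.single k 1 : ι →₀ ℕ) i).factorial : ℚ)) (Finset.mem_univ k)
  rw [← h1, ← h2, ← mul_assoc]
  congr 1
  · obtain ⟨m, hm⟩ := Nat.exists_eq_succ_of_ne_zero h
    simp [hm, Nat.factorial_succ]
  · apply Finset.prod_congr rfl
    intro i hi
    have : k ≠ i := (Finset.ne_of_mem_erase hi).symm
    simp [this]

/-- Fischer form along an additive functional. -/
noncomputable def fis (φ : K →+ ℚ) (f g : MvPolynomial ι K) : ℚ :=
  ∑ α ∈ f.support, fac α * φ (coeff α f) * φ (coeff α g)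

variable (φ : K →+ ℚ)

theorem fis_eq_sum {f : MvPolynomial ι K} {s : Finset (ι →₀ ℕ)} (h : f.support ⊆ s)
    (g : MvPolynomial ι K) :
    fis φ f g = ∑ α ∈ s, fac α * φ (coeff α f) * φ (coeff α g) := by
  apply Finset.sum_subset h
  intro α _ hα
  rw [notMem_support_iff.1 hα]; simp

theorem fis_add_left (f f' g : MvPolynomial ι K) : fis φ (f + f') g = fis φ f g + fis φ f' g := by
  rw [fis_eq_sum φ (f := f + f') (s := f.support ∪ f'.support) support_add,
    fis_eq_sum φ (f := f) (s := f.support ∪ f'.support) Finset.subset_union_left,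
    fis_eq_sum φ (f := f') (s := f.support ∪ f'.support) Finset.subset_union_right,
    ← Finset.sum_add_distrib]
  apply Finset.sum_congr rfl
  intro α _
  simp only [coeff_add, map_add]; ring

theorem fis_add_right (f g g' : MvPolynomial ι K) : fis φ f (g + g') = fis φ f g + fis φ f g' := by
  unfold fis
  rw [← Finset.sum_add_distrib]
  apply Finset.sum_congr rfl
  intro α _
  simp only [coeff_add, map_add]; ring

/-- the Fischer form as a biadditive map -/
noncomputable def fisH : MvPolynomial ι K →+ MvPolynomial ι K →+ ℚ :=
  AddMonoidHom.mk' (fun f => AddMonoidHom.mk' (fis φ f) (fis_add_right φ f))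
    (fun f f' => AddMonoidHom.ext fun g => fis_add_left φ f f' g)

theorem fisH_apply (f g : MvPolynomial ι K) : fisH φ f g = fis φ f g := rfl

theorem fisH_monomial (α : ι →₀ ℕ) (a : K) (g : MvPolynomial ι K) :
    fisH φ (monomial α a) g = fac α * φ a * φ (coeff α g) := by
  rw [fisH_apply, fis_eq_sum φ (support_monomial_subset)]
  simp

theorem fisH_pderiv (k : ι) (f g : MvPolynomial ι K) :
    fisH φ (pderiv k f) g = fisH φ f (X k * g) := by
  induction f using MvPolynomial.induction_on' with
  | add p q hp hq => simp only [map_add, AddMonoidHom.add_apply, hp, hq]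
  | monomial α a =>
    rw [pderiv_monomial, fisH_monomial, fisH_monomial, coeff_X_mul']
    by_cases h : α k = 0
    · simp [h]
    · rw [if_pos (by simpa using h), fac_sub α k h]
      have : φ (a * (α k : K)) = φ a * (α k : ℚ) := by
        rw [mul_comm a, ← nsmul_eq_mul, map_nsmul, nsmul_eq_mul, mul_comm]
      rw [this]; ring

theorem fisH_self_nonneg (f : MvPolynomial ι K) : 0 ≤ fisH φ f f := by
  apply Finset.sum_nonneg
  intro α _
  have := fac_pos α
  rw [mul_assoc]
  exact mul_nonneg this.le (mul_self_nonneg _)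

theorem fisH_self_eq_zero (f : MvPolynomial ι K) (h : fisH φ f f = 0) (α : ι →₀ ℕ) :
    φ (coeff α f) = 0 := by
  by_cases hα : α ∈ f.support
  · have h1 := (Finset.sum_eq_zero_iff_of_nonneg (fun α _ => by
      have := fac_pos α
      rw [mul_assoc]
      exact mul_nonneg this.le (mul_self_nonneg _))).1 h α hα
    have := fac_pos α
    rw [mul_assoc] at h1
    simpa [this.ne'] using h1
  · rw [notMem_support_iff.1 hα]; simp

end Fischer

section Model
variable (K : Type*) [Field K] {ι : Type*} [Fintype ι] [DecidableEq ι]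

/-- second-order differential operators -/
noncomputable def Dop : Sym2 ι → (MvPolynomial ι K →ₗ[K] MvPolynomial ι K) :=
  Sym2.lift ⟨fun i j => (pderiv i).toLinearMap ∘ₗ (pderiv j).toLinearMap, fun i j => by
    ext1 f; exact LinearMap.ext fun x => pderiv_comm i j _⟩

theorem Dop_mk (i j : ι) (f : MvPolynomial ι K) : Dop K s(i, j) f = pderiv i (pderiv j f) := rfl

/-- alternating polynomial-valued functions -/
abbrev T (ι : Type*) (a : ℕ) := (Sym2 ι →₀ K) [⋀^Fin a]→ₗ[K] MvPolynomial ι K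

/-- basis vector -/
noncomputable def ev (q : ι × ι) : Sym2 ι →₀ K := Finsupp.single s(q.1, q.2) 1

variable {K}

/-- model differential -/
noncomputable def dd (a : ℕ) : T K ι (a + 1) →ₗ[K] T K ι a where
  toFun G := ∑ q : ι × ι, (X q.1 * X q.2 : MvPolynomial ι K) • G.curryLeft (ev K q)
  map_add' G H := by simp [Finset.sum_add_distrib]
  map_smul' c G := by 
    simp only [AlternatingMap.curryLeft_smul, LinearMap.smul_apply, RingHom.id_apply,
      Finset.smul_sum]
    exact Finset.sum_congr rfl fun q _ => smul_comm _ _ _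

theorem dd_apply (a : ℕ) (G : T K ι (a + 1)) (v : Fin a → (Sym2 ι →₀ K)) :
    dd a G v = ∑ q : ι × ι, X q.1 * X q.2 * G (Matrix.vecCons (ev K q) v) := by
  
  have h : ∀ (s : Finset (ι × ι)) (f : ι × ι → T K ι a), (∑ q ∈ s, f q) v = ∑ q ∈ s, f q v := by
    intro s f
    induction s using Finset.induction_on with
    | empty => simp
    | insert q s hq ih => simp [Finset.sum_insert hq, ih]
  simp [dd, h]

/-- adjoint differential -/
noncomputable def ds (a : ℕ) (G : T K ι a) : T K ι (a + 1) :=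
  AlternatingMap.alternatizeUncurryFin
    (Finsupp.linearCombination K (fun s => (Dop K s).compAlternatingMap G))

theorem ds_apply (a : ℕ) (G : T K ι a) (p : Fin (a + 1) → ι × ι) :
    ds a G (fun r => ev K (p r)) = ∑ r : Fin (a + 1), (-1) ^ (r : ℕ) •
      pderiv (p r).1 (pderiv (p r).2 (G (fun t => ev K (r.removeNth p t)))) := by
  rw [ds, AlternatingMap.alternatizeUncurryFin_apply]
  apply Finset.sum_congr rfl
  intro r _
  simp [ev, Finsupp.linearCombination_single, Dop_mk]
  rfl

theorem dd_dd (a : ℕ) (G : T K ι (a + 2)) [CharZero K] : dd a (dd (a + 1) G) = 0 := by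
  ext1 v
  rw [dd_apply]
  simp only [dd_apply, Finset.mul_sum]
  set F := ∑ q : ι × ι, ∑ q' : ι × ι, X q.1 * X q.2 * (X q'.1 * X q'.2 *
    G (Matrix.vecCons (ev K q') (Matrix.vecCons (ev K q) v))) with hF
  have h : F = -F := by
    conv_lhs => rw [hF, Finset.sum_comm]
    rw [hF, ← Finset.sum_neg_distrib]
    apply Finset.sum_congr rfl
    intro q _
    rw [← Finset.sum_neg_distrib]
    apply Finset.sum_congr rfl
    intro q' _
    have : G (Matrix.vecCons (ev K q) (Matrix.vecCons (ev K q') v)) =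
        - G (Matrix.vecCons (ev K q') (Matrix.vecCons (ev K q) v)) := by
      rw [← AlternatingMap.map_swap G _ (show (0 : Fin (a + 2)) ≠ 1 by simp)]
      congr 1
      ext1 i
      refine Fin.cases ?_ (fun i => Fin.cases ?_ (fun i => ?_) i) i
      · simp
      · simp
      · have h1 : (i.succ.succ : Fin (a + 2)) ≠ 0 := Fin.succ_ne_zero _
        have h2 : (i.succ.succ : Fin (a + 2)) ≠ 1 := by
          intro h; have := congrArg Fin.val h; simp at this
        simp [Equiv.swap_apply_of_ne_of_ne h1 h2]
    rw [this]; ring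
  have h2 : F + F = 0 := by nth_rw 1 [h]; simp
  exact self_eq_neg.1 h

theorem euler2 {b : ℕ} {f : MvPolynomial ι K} (hf : f.IsHomogeneous b) :
    ∑ q : ι × ι, X q.1 * X q.2 * pderiv q.1 (pderiv q.2 f) = (b * (b - 1)) • f := by
  rw [Fintype.sum_prod_type, Finset.sum_comm]
  have h1 : ∀ j, ∑ i, X i * X j * pderiv i (pderiv j f) = (b - 1) • (X j * pderiv j f) := by
    intro j
    have := (hf.pderiv (i := j)).sum_X_mul_pderiv
    rw [← mul_smul_comm, ← this, Finset.mul_sum]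
    apply Finset.sum_congr rfl
    intro i _; ring
  simp only [h1]
  rw [← Finset.smul_sum, hf.sum_X_mul_pderiv, smul_smul, mul_comm]

theorem comm_term (k l i j : ι) (F : MvPolynomial ι K) :
    pderiv k (pderiv l (X i * X j * F)) = X i * X j * pderiv k (pderiv l F)
      + (if k = i then X j * pderiv l F else 0) + (if k = j then X i * pderiv l F else 0)
      + (if l = i then X j * pderiv k F else 0) + (if l = j then X i * pderiv k F else 0)
      + (if k = i then (if l = j then F else 0) else 0)
      + (if k = j then (if l = i then F else 0) else 0) := by
  simp only [pderiv_mul, pderiv_X, Pi.single_apply, map_add]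
  have e : ∀ (c : Prop) [Decidable c] (m : ι), pderiv m (if c then (1 : MvPolynomial ι K) else 0) = 0 := by
    intro c _ m; split_ifs <;> simp
  simp only [e]
  simp only [eq_comm (a := i), eq_comm (a := j)]
  split_ifs <;> ring

theorem ev_swap (i j : ι) : ev K (i, j) = ev K (j, i) := by
  simp [ev, Sym2.eq_swap]

theorem comm_sum (k l : ι) (H : ι × ι → MvPolynomial ι K) (hH : ∀ i j, H (i, j) = H (j, i)) :
    pderiv k (pderiv l (∑ q : ι × ι, X q.1 * X q.2 * H q)) =
      ∑ q : ι × ι, X q.1 * X q.2 * pderiv k (pderiv l (H q))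
      + (2 * H (k, l) + 2 * ∑ j, X j * pderiv l (H (k, j)) + 2 * ∑ j, X j * pderiv k (H (l, j))) := by
  simp only [map_sum, comm_term, Finset.sum_add_distrib, Fintype.sum_prod_type]
  simp only [Finset.sum_ite_eq, Finset.mem_univ, if_true, Finset.sum_ite_irrel,
    Finset.sum_const_zero]
  have s1 : ∑ x, X x * pderiv l (H (x, k)) = ∑ x, X x * pderiv l (H (k, x)) :=
    Finset.sum_congr rfl fun x _ => by rw [hH]
  have s2 : ∑ x, X x * pderiv k (H (x, l)) = ∑ x, X x * pderiv k (H (l, x)) :=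
    Finset.sum_congr rfl fun x _ => by rw [hH]
  rw [s1, s2, hH l k]
  ring


theorem cons_ev {a : ℕ} (q : ι × ι) (p : Fin a → ι × ι) :
    Matrix.vecCons (ev K q) (fun r => ev K (p r)) = fun r => ev K (Matrix.vecCons q p r) := by
  ext1 r
  refine Fin.cases ?_ (fun r => ?_) r <;> simp

theorem insertNth_ev {a : ℕ} (r : Fin (a + 1)) (q : ι × ι) (p : Fin a → ι × ι) :
    (fun t => ev K (r.insertNth (α := fun _ => ι × ι) q p t)) =
      r.insertNth (α := fun _ => Sym2 ι →₀ K) (ev K q) (fun t => ev K (p t)) := by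
  ext1 t
  refine Fin.succAboveCases r ?_ (fun t => ?_) t <;> simp

theorem removeNth_zero_cons {α : Type*} {a : ℕ} (q : α) (p : Fin a → α) :
    (0 : Fin (a + 1)).removeNth (Matrix.vecCons q p) = p := by
  ext1 t; simp [Fin.removeNth]

theorem removeNth_succ_cons {α : Type*} {a : ℕ} (q : α) (p : Fin (a + 1) → α) (r : Fin (a + 1)) :
    r.succ.removeNth (Matrix.vecCons q p) = Matrix.vecCons q (r.removeNth p) := by
  ext1 t
  refine Fin.cases ?_ (fun t => ?_) t <;> simp [Fin.removeNth]

theorem T_ext {a : ℕ} {G H : T K ι a}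
    (h : ∀ p : Fin a → ι × ι, G (fun r => ev K (p r)) = H (fun r => ev K (p r))) : G = H := by
  refine Module.Basis.ext_alternating (Finsupp.basisSingleOne (R := K) (ι := Sym2 ι)) ?_
  intro v _
  have hv : ∀ r, ∃ q : ι × ι, s(q.1, q.2) = v r := fun r => by
    induction v r using Sym2.ind with | _ x y => exact ⟨(x, y), rfl⟩
  choose p hp using hv
  have := h p
  simpa [ev, hp] using this

/-- evaluation on basis vectors -/
noncomputable def gg {a : ℕ} (G : T K ι a) (p : Fin a → ι × ι) : MvPolynomial ι K :=
  G (fun r => ev K (p r))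

theorem gg_dd {a : ℕ} (G : T K ι (a + 1)) (p : Fin a → ι × ι) :
    gg (dd a G) p = ∑ q : ι × ι, X q.1 * X q.2 * gg G (Matrix.vecCons q p) := by
  simp only [gg, dd_apply, cons_ev]

theorem gg_ds {a : ℕ} (G : T K ι a) (p : Fin (a + 1) → ι × ι) :
    gg (ds a G) p = ∑ r : Fin (a + 1), (-1) ^ (r : ℕ) •
      pderiv (p r).1 (pderiv (p r).2 (gg G (r.removeNth p))) := by
  simp only [gg, ds_apply]

theorem gg_insertNth {a : ℕ} (G : T K ι (a + 1)) (r : Fin (a + 1)) (q : ι × ι)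
    (p : Fin a → ι × ι) :
    gg G (r.insertNth (α := fun _ => ι × ι) q p) = (-1) ^ (r : ℕ) • gg G (Matrix.vecCons q p) := by
  rw [gg, insertNth_ev, AlternatingMap.map_insertNth, gg, cons_ev]

theorem gg_swap {a : ℕ} (G : T K ι (a + 1)) (i j : ι) (p : Fin a → ι × ι) :
    gg G (Matrix.vecCons (i, j) p) = gg G (Matrix.vecCons (j, i) p) := by
  rw [gg, gg, ← cons_ev, ← cons_ev, ev_swap]

/-- the zeroth order part of the Laplacian -/
noncomputable def zz {a : ℕ} (G : T K ι (a + 1)) (q : ι × ι) (p : Fin a → ι × ι) :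
    MvPolynomial ι K :=
  2 * gg G (Matrix.vecCons q p)
    + 2 * ∑ j, X j * pderiv q.2 (gg G (Matrix.vecCons (q.1, j) p))
    + 2 * ∑ j, X j * pderiv q.1 (gg G (Matrix.vecCons (q.2, j) p))

theorem box {a b : ℕ} (G : T K ι (a + 1)) (hG : ∀ p, (gg G p).IsHomogeneous b)
    (p : Fin (a + 1) → ι × ι) :
    gg (dd (a + 1) (ds (a + 1) G)) p + gg (ds a (dd a G)) p =
      (b * (b - 1)) • gg G p + ∑ r : Fin (a + 1), (-1) ^ (r : ℕ) • zz G (p r) (r.removeNth p) := by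
  rw [gg_dd, gg_ds]
  simp only [gg_ds, gg_dd]
  simp only [Fin.sum_univ_succ (n := a + 1), removeNth_zero_cons, removeNth_succ_cons,
    Matrix.cons_val_zero, Matrix.cons_val_succ, Fin.val_zero, pow_zero, one_smul, Fin.val_succ,
    mul_add, Finset.sum_add_distrib]
  rw [euler2 (hG p), add_assoc]
  congr 1
  have h : ∀ r : Fin (a + 1), pderiv (p r).1 (pderiv (p r).2
      (∑ q : ι × ι, X q.1 * X q.2 * gg G (Matrix.vecCons q (r.removeNth p)))) =
      ∑ q : ι × ι, X q.1 * X q.2 * pderiv (p r).1 (pderiv (p r).2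
        (gg G (Matrix.vecCons q (r.removeNth p)))) + zz G (p r) (r.removeNth p) := by
    intro r
    rw [comm_sum _ _ _ (fun i j => gg_swap G i j _)]
    rfl
  simp only [h, smul_add, Finset.sum_add_distrib]
  rw [← add_assoc]
  convert zero_add _
  simp only [Finset.mul_sum]
  rw [Finset.sum_comm, ← Finset.sum_add_distrib]
  apply Finset.sum_eq_zero
  intro r _
  rw [Finset.smul_sum, ← Finset.sum_add_distrib]
  apply Finset.sum_eq_zero
  intro q _
  rw [pow_succ, mul_smul_comm]
  simp

theorem key (φ : K →+ ℚ) (h : ι → MvPolynomial ι K) :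
    ∑ l, fisH φ (∑ j, X j * pderiv l (h j)) (h l) =
      fisH φ (∑ j, X j * h j) (∑ j, X j * h j) - ∑ l, fisH φ (h l) (h l) := by
  have h1 : ∀ l, pderiv l (∑ j, X j * h j) = h l + ∑ j, X j * pderiv l (h j) := by
    intro l
    simp only [map_sum, pderiv_mul, pderiv_X, Pi.single_apply, Finset.sum_add_distrib]
    simp
  have h2 : fisH φ (∑ j, X j * h j) (∑ j, X j * h j) =
      ∑ l, fisH φ (pderiv l (∑ j, X j * h j)) (h l) := by
    rw [map_sum]
    exact Finset.sum_congr rfl fun l _ => (fisH_pderiv φ _ _ _).symm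
  rw [h2, eq_sub_iff_add_eq, ← Finset.sum_add_distrib]
  apply Finset.sum_congr rfl
  intro l _
  rw [h1, map_add, AddMonoidHom.add_apply, add_comm]

theorem fisH_two_mul (φ : K →+ ℚ) (f g : MvPolynomial ι K) :
    fisH φ (2 * f) g = 2 * fisH φ f g := by
  rw [two_mul, map_add, AddMonoidHom.add_apply, two_mul]

theorem zz_bound {a : ℕ} (φ : K →+ ℚ) (G : T K ι (a + 1)) (p : Fin a → ι × ι) :
    -2 * ∑ q : ι × ι, fisH φ (gg G (Matrix.vecCons q p)) (gg G (Matrix.vecCons q p)) ≤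
      ∑ q : ι × ι, fisH φ (zz G q p) (gg G (Matrix.vecCons q p)) := by
  set N := ∑ q : ι × ι, fisH φ (gg G (Matrix.vecCons q p)) (gg G (Matrix.vecCons q p)) with hN
  have hN' : N = ∑ k, ∑ l, fisH φ (gg G (Matrix.vecCons (k, l) p)) (gg G (Matrix.vecCons (k, l) p)) :=
    by rw [hN, Fintype.sum_prod_type]
  have hk : ∀ k, - ∑ l, fisH φ (gg G (Matrix.vecCons (k, l) p)) (gg G (Matrix.vecCons (k, l) p)) ≤
      ∑ l, fisH φ (∑ j, X j * pderiv l (gg G (Matrix.vecCons (k, j) p)))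
        (gg G (Matrix.vecCons (k, l) p)) := by
    intro k
    rw [key φ (fun j => gg G (Matrix.vecCons (k, j) p))]
    have := fisH_self_nonneg φ (∑ j, X j * gg G (Matrix.vecCons (k, j) p))
    linarith
  have hA : -N ≤ ∑ q : ι × ι, fisH φ (∑ j, X j * pderiv q.2 (gg G (Matrix.vecCons (q.1, j) p)))
      (gg G (Matrix.vecCons q p)) := by
    rw [hN', Fintype.sum_prod_type, ← Finset.sum_neg_distrib]
    exact Finset.sum_le_sum fun k _ => hk k
  have hB : -N ≤ ∑ q : ι × ι, fisH φ (∑ j, X j * pderiv q.1 (gg G (Matrix.vecCons (q.2, j) p)))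
      (gg G (Matrix.vecCons q p)) := by
    rw [hN', Fintype.sum_prod_type, ← Finset.sum_neg_distrib, Finset.sum_comm]
    refine Finset.sum_le_sum fun k _ => ?_
    exact (hk k).trans_eq (Finset.sum_congr rfl fun l _ => by rw [gg_swap G k l])
  simp only [zz, map_add, AddMonoidHom.add_apply, fisH_two_mul, Finset.sum_add_distrib,
    ← Finset.mul_sum]
  rw [← hN]
  linarith

theorem fisH_sign {φ : K →+ ℚ} (r : ℕ) (f g : MvPolynomial ι K) :
    fisH φ ((-1 : ℤ) ^ r • f) ((-1 : ℤ) ^ r • g) = fisH φ f g := by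
  rcases neg_one_pow_eq_or ℤ r with h | h <;> simp [h]

theorem sum_insertNth {a : ℕ} (r : Fin (a + 1)) (f : (Fin (a + 1) → ι × ι) → ℚ) :
    ∑ p, f p = ∑ p : Fin a → ι × ι, ∑ q : ι × ι, f (r.insertNth (α := fun _ => ι × ι) q p) := by
  rw [← (Fin.insertNthEquiv (fun _ => ι × ι) r).sum_comp, Fintype.sum_prod_type, Finset.sum_comm]
  rfl

theorem laplacian_inj [CharZero K] {a b : ℕ} (hab : 2 * (a + 1) < b * (b - 1))
    (G : T K ι (a + 1)) (hG : ∀ p, (gg G p).IsHomogeneous b)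
    (h : ∀ p, gg (dd (a + 1) (ds (a + 1) G)) p + gg (ds a (dd a G)) p = 0) : G = 0 := by
  apply T_ext
  intro p₀
  change gg G p₀ = 0
  ext α
  rw [coeff_zero]
  rw [← Module.forall_dual_apply_eq_zero_iff ℚ]
  intro ψ
  set φ : K →+ ℚ := ψ.toAddMonoidHom with hφ
  change φ _ = 0
  set N := ∑ p, fisH φ (gg G p) (gg G p) with hN
  set A := ∑ p : Fin a → ι × ι, ∑ q : ι × ι, fisH φ (zz G q p) (gg G (Matrix.vecCons q p)) with hA
  have hN0 : N = ∑ p : Fin a → ι × ι, ∑ q : ι × ι,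
      fisH φ (gg G (Matrix.vecCons q p)) (gg G (Matrix.vecCons q p)) := by
    rw [hN, sum_insertNth 0]
    simp only [gg_insertNth, fisH_sign]
  have hNA : -2 * N ≤ A := by
    rw [hN0, hA, Finset.mul_sum]
    exact Finset.sum_le_sum fun p _ => zz_bound φ G p
  have hr : ∀ r : Fin (a + 1), ∑ p, fisH φ ((-1 : ℤ) ^ (r : ℕ) • zz G (p r) (r.removeNth p)) (gg G p)
      = A := by
    intro r
    rw [sum_insertNth r]
    simp only [gg_insertNth, Fin.insertNth_apply_same, Fin.removeNth_insertNth]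
    simp only [fisH_sign]
    rfl
  have h0 : (b * (b - 1) : ℕ) * N + (a + 1 : ℕ) * A = 0 := by
    have : ∑ p, fisH φ (gg (dd (a + 1) (ds (a + 1) G)) p + gg (ds a (dd a G)) p) (gg G p) = 0 := by
      simp [h]
    simp only [box G hG] at this
    simp only [map_add, AddMonoidHom.add_apply, map_sum, AddMonoidHom.finsetSum_apply, map_nsmul,
      AddMonoidHom.nsmul_apply, Finset.sum_add_distrib] at this
    rw [Finset.sum_comm, Finset.sum_congr rfl (fun r _ => hr r)] at this
    simpa [← Finset.mul_sum, nsmul_eq_mul] using this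
  have hNn : 0 ≤ N := Finset.sum_nonneg fun p _ => fisH_self_nonneg φ _
  have hlt : ((2 * (a + 1) : ℕ) : ℚ) < ((b * (b - 1) : ℕ) : ℚ) := by exact_mod_cast hab
  have hN00 : N = 0 := by
    have h1 : ((a + 1 : ℕ) : ℚ) * (-2 * N) ≤ (a + 1 : ℕ) * A :=
      mul_le_mul_of_nonneg_left hNA (by positivity)
    push_cast at *
    nlinarith
  have := (Finset.sum_eq_zero_iff_of_nonneg (fun p _ => fisH_self_nonneg φ (gg G p))).1 hN00 p₀
    (Finset.mem_univ _)
  exact fisH_self_eq_zero φ _ this α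

/-- adjoint differential, linear version -/
noncomputable def dsL (a : ℕ) : T K ι a →ₗ[K] T K ι (a + 1) where
  toFun := ds a
  map_add' G H := by
    apply T_ext; intro p
    change gg _ p = gg (ds a G) p + gg (ds a H) p
    simp only [gg_ds, ← Finset.sum_add_distrib, ← smul_add, ← map_add]
    rfl
  map_smul' c G := by
    apply T_ext; intro p
    change gg _ p = c • gg (ds a G) p
    simp only [gg_ds, Finset.smul_sum]
    apply Finset.sum_congr rfl
    intro r _
    rw [smul_comm, ← Derivation.map_smul, ← Derivation.map_smul]
    rfl

/-- homogeneous cycles -/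
noncomputable def WW (K : Type*) [Field K] (ι : Type*) [Fintype ι] [DecidableEq ι] (a b : ℕ) :
    Submodule K (T K ι (a + 1)) where
  carrier := {G | (∀ p, (gg G p).IsHomogeneous b) ∧ dd a G = 0}
  zero_mem' := ⟨fun p => isHomogeneous_zero _ _ _, map_zero _⟩
  add_mem' := fun {G H} hG hH => ⟨fun p => (hG.1 p).add (hH.1 p), by rw [map_add, hG.2, hH.2, add_zero]⟩
  smul_mem' := fun c G hG => ⟨fun p => (homogeneousSubmodule ι K b).smul_mem c (hG.1 p), by
    rw [map_smul, hG.2, smul_zero]⟩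

instance WW_finite (a b : ℕ) : FiniteDimensional K (WW K ι a b) := by
  have : Module.Finite K (homogeneousSubmodule ι K b) :=
    Module.Finite.iff_fg.2 (homogeneousSubmodule_fg ι K b)
  let f : WW K ι a b →ₗ[K] ((Fin (a + 1) → ι × ι) → homogeneousSubmodule ι K b) :=
    { toFun := fun G p => ⟨gg G.1 p, G.2.1 p⟩
      map_add' := fun G H => rfl
      map_smul' := fun c G => rfl }
  refine Module.Finite.of_injective f ?_
  intro G H h
  apply Subtype.ext
  apply T_ext
  intro p
  exact congrArg Subtype.val (congrFun h p)

theorem ds_homog {a b : ℕ} (G : T K ι a) (hG : ∀ p, (gg G p).IsHomogeneous (b + 2)) (p) :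
    (gg (ds a G) p).IsHomogeneous b := by
  rw [gg_ds]
  refine (homogeneousSubmodule ι K b).sum_mem fun r _ => ?_
  refine zsmul_mem (S := Submodule K (MvPolynomial ι K)) (K := homogeneousSubmodule ι K b) ?_ _
  exact (hG _).pderiv.pderiv

theorem dd_homog {a b : ℕ} (G : T K ι (a + 1)) (hG : ∀ p, (gg G p).IsHomogeneous b) (p) :
    (gg (dd a G) p).IsHomogeneous (b + 2) := by
  rw [gg_dd]
  refine (homogeneousSubmodule ι K (b + 2)).sum_mem fun r _ => ?_
  have := ((isHomogeneous_X K r.1).mul (isHomogeneous_X K r.2)).mul (hG (Matrix.vecCons r p))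
  rw [add_comm b]; exact this

theorem model_exact [CharZero K] {a b : ℕ} (hab : 2 * (a + 1) < (b + 2) * (b + 1))
    (G : T K ι (a + 1)) (hG : ∀ p, (gg G p).IsHomogeneous (b + 2)) (h : dd a G = 0) :
    ∃ H : T K ι (a + 2), (∀ p, (gg H p).IsHomogeneous b) ∧ dd (a + 1) H = G := by
  let L : WW K ι a (b + 2) →ₗ[K] WW K ι a (b + 2) :=
    ((dd (a + 1) ∘ₗ dsL (a + 1)) ∘ₗ (WW K ι a (b + 2)).subtype).codRestrict _ (fun G =>
      ⟨fun p => dd_homog _ (fun p => ds_homog _ G.2.1 p) p, dd_dd _ _⟩)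
  have hL : Function.Injective L := by
    rw [injective_iff_map_eq_zero]
    intro G hG
    apply Subtype.ext
    apply laplacian_inj (b := b + 2) (by simpa using hab) G.1 G.2.1
    intro p
    have h1 : dd (a + 1) (ds (a + 1) G.1) = 0 := congrArg Subtype.val hG
    have h2 : ds a (0 : T K ι a) = 0 := map_zero (dsL a)
    rw [G.2.2, h1, h2]
    simp [gg]
  have hs : Function.Surjective L := LinearMap.surjective_of_injective (V := WW K ι a (b + 2)) (K := K) (f := L) hL
  obtain ⟨H, hH⟩ := hs ⟨G, hG, h⟩
  exact ⟨ds (a + 1) H.1, fun p => ds_homog _ H.2.1 p, congrArg Subtype.val hH⟩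

end Model
end VK

namespace VK
open MvPolynomial TensorProduct exteriorPower

section Transport
variable {K : Type*} [Field K] {n : ℕ}

theorem wedge_eq {a : ℕ} (v : Fin a → S K n 2) : wedge K a v = ιMulti K a v := rfl

theorem skipAt_eq {a : ℕ} (j : Fin (a + 1)) (i : Fin a) :
    skipAt j (i : Fin (a + 1 - 1)) = j.succAbove i := by
  unfold skipAt Fin.succAbove
  by_cases h : (i : ℕ) < j
  · rw [if_pos h, if_pos (by simpa [Fin.lt_def] using h)]; rfl
  · rw [if_neg h, if_neg (by simpa [Fin.lt_def] using h)]; rfl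

/-- coordinate functionals on quadrics -/
noncomputable def theta (K : Type*) [Field K] (n : ℕ) :
    (Sym2 (Fin (n + 1)) →₀ K) →ₗ[K] Module.Dual K (S K n 2) :=
  Finsupp.linearCombination K fun e => (lcoeff K 0 ∘ₗ Dop K e) ∘ₗ (S K n 2).subtype

theorem theta_ev (q : Fin (n + 1) × Fin (n + 1)) (s : S K n 2) :
    theta K n (ev K q) s = coeff 0 (pderiv q.1 (pderiv q.2 (s : MvPolynomial (Fin (n + 1)) K))) := by
  simp only [theta, ev, Finsupp.linearCombination_single, one_smul]; rfl

/-- quadratic monomials -/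
noncomputable def xx (K : Type*) [Field K] {n : ℕ} (q : Fin (n + 1) × Fin (n + 1)) : S K n 2 :=
  ⟨X q.1 * X q.2, (isHomogeneous_X K q.1).mul (isHomogeneous_X K q.2)⟩

theorem theta_sum (s : S K n 2) :
    ∑ q, theta K n (ev K q) s • xx K q = (2 : K) • s := by
  apply Subtype.ext
  have h := euler2 (b := 2) ((mem_homogeneousSubmodule _ _).1 s.2)
  simp only [Submodule.coe_sum, Submodule.coe_smul, xx]
  rw [show ((2 : K) • (s : MvPolynomial (Fin (n + 1)) K)) = (2 * (2 - 1) : ℕ) • (s : MvPolynomial (Fin (n + 1)) K) by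
    simp [two_smul]]
  rw [← h]
  refine Finset.sum_congr rfl fun q _ => ?_
  have hh : (pderiv q.1 (pderiv q.2 (s : MvPolynomial (Fin (n + 1)) K))).IsHomogeneous 0 :=
    (((mem_homogeneousSubmodule _ _).1 s.2).pderiv (i := q.2)).pderiv (i := q.1)
  have h2 := totalDegree_eq_zero_iff_eq_C.1 ((totalDegree_zero_iff_isHomogeneous _).2 hh)
  rw [theta_ev]
  conv_rhs => rw [h2]
  rw [smul_eq_C_mul, mul_comm]

theorem theta_sum_val (s : S K n 2) :
    ∑ q, theta K n (ev K q) s • (X q.1 * X q.2 : MvPolynomial (Fin (n + 1)) K) =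
      (2 : K) • (s : MvPolynomial (Fin (n + 1)) K) := by
  have := congrArg Subtype.val (theta_sum s)
  simpa [xx, Submodule.coe_sum] using this

/-- alternating pairing -/
noncomputable def alt (K : Type*) [Field K] (n a : ℕ) :
    (Sym2 (Fin (n + 1)) →₀ K) [⋀^Fin a]→ₗ[K] Module.Dual K (⋀[K]^a (S K n 2)) :=
  (alternatingMapToDual K (S K n 2) a).compLinearMap (theta K n)

/-- evaluation of functionals on the exterior factor -/
noncomputable def evL (K : Type*) [Field K] (n a b : ℕ) :
    ((⋀[K]^a (S K n 2)) ⊗[K] (S K n b)) →ₗ[K]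
      (Module.Dual K (⋀[K]^a (S K n 2)) →ₗ[K] MvPolynomial (Fin (n + 1)) K) :=
  TensorProduct.lift (LinearMap.mk₂ K
    (fun ω w => (Module.Dual.eval K _ ω).smulRight (w : MvPolynomial (Fin (n + 1)) K))
    (fun _ _ _ => by ext1; simp [add_smul])
    (fun _ _ _ => by ext1; simp [mul_smul])
    (fun _ _ _ => by ext1; simp)
    (fun c _ _ => by ext1; simp [smul_comm c]))

theorem evL_tmul {a b : ℕ} (ω : ⋀[K]^a (S K n 2)) (w : S K n b) (f) :
    evL K n a b (ω ⊗ₜ w) f = f ω • (w : MvPolynomial (Fin (n + 1)) K) := rfl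

/-- map to the model -/
noncomputable def Phi (K : Type*) [Field K] (n a b : ℕ) :
    ((⋀[K]^a (S K n 2)) ⊗[K] (S K n b)) →ₗ[K] T K (Fin (n + 1)) a where
  toFun z := (evL K n a b z).compAlternatingMap (alt K n a)
  map_add' x y := by ext1 v; simp
  map_smul' c x := by ext1 v; simp

theorem Phi_tmul {a b : ℕ} (s : Fin a → S K n 2) (w : S K n b) (v) :
    Phi K n a b (wedge K a s ⊗ₜ w) v =
      Matrix.det (.of fun i j => theta K n (v j) (s i)) • (w : MvPolynomial (Fin (n + 1)) K) := by
  rw [wedge_eq]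
  change evL K n a b (_ ⊗ₜ w) (alternatingMapToDual K (S K n 2) a fun i => theta K n (v i)) = _
  rw [evL_tmul, alternatingMapToDual_apply_ιMulti]

theorem gen_induction {a b : ℕ} {P : ((⋀[K]^a (S K n 2)) ⊗[K] (S K n b)) → Prop}
    (h0 : P 0) (hadd : ∀ x y, P x → P y → P (x + y)) 
    (hg : ∀ s w, P (wedge K a s ⊗ₜ w)) (z) : P z := by
  induction z using TensorProduct.induction_on with
  | zero => exact h0
  | add x y hx hy => exact hadd x y hx hy
  | tmul ω w =>
    have : ω ∈ Submodule.span K (Set.range (ιMulti K a (M := S K n 2))) := by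
      rw [ιMulti_span]; trivial
    have key : ∀ w : S K n b, P (ω ⊗ₜ w) := by
      induction this using Submodule.span_induction with
      | mem x h => obtain ⟨s, rfl⟩ := h; exact fun w => hg s w
      | zero => intro w; simpa using h0
      | add x y _ _ hx hy => intro w; rw [add_tmul]; exact hadd _ _ (hx w) (hy w)
      | smul c x _ hx => intro w; rw [smul_tmul]; exact hx _
    exact key w

theorem Phi_homog {a b : ℕ} (z) (p : Fin a → Fin (n + 1) × Fin (n + 1)) :
    (gg (Phi K n a b z) p).IsHomogeneous b := by
  change gg (Phi K n a b z) p ∈ homogeneousSubmodule _ _ _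
  have : gg (Phi K n a b z) p = evL K n a b z (alt K n a fun r => ev K (p r)) := rfl
  rw [this]
  clear this
  induction z using gen_induction with
  | h0 => simp
  | hadd x y hx hy => rw [map_add]; exact Submodule.add_mem _ hx hy
  | hg s w => rw [evL_tmul]; exact Submodule.smul_mem _ _ w.2

theorem Phi_delta {a b : ℕ} {δ} (hδ : IsKoszulMap K n 2 (a + 1) b δ) (z) :
    dd a (Phi K n (a + 1) b z) = (2 : K) • Phi K n a (b + 2) (δ z) := by
  refine gen_induction (P := fun z => dd a (Phi K n (a + 1) b z) =
    (2 : K) • Phi K n a (b + 2) (δ z)) (by simp) (fun x y hx hy => ?_) (fun s w => ?_) z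
  · simp only [map_add, hx, hy, smul_add]
  ext1 v
  rw [dd_apply, hδ]
  simp only [Phi_tmul, map_sum, map_smul]
  have e : ∀ q, Matrix.det (.of fun i j => theta K n (Matrix.vecCons (ev K q) v j) (s i)) =
      ∑ i : Fin (a + 1), (-1 : K) ^ (i : ℕ) * theta K n (ev K q) (s i) *
        Matrix.det (.of fun i' j => theta K n (v j) (s (i.succAbove i'))) := by
    intro q
    rw [Matrix.det_succ_column_zero]
    rfl
  simp only [e]
  rw [AlternatingMap.smul_apply]
  have e2 : ∀ j : Fin (a + 1), (Phi K n a (b + 2) ((wedge K a fun i => s (skipAt j i)) ⊗ₜ[K] mulSW K (s j) w)) v =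
      Matrix.det (.of fun i' j' => theta K n (v j') (s (j.succAbove i'))) •
        ((s j : MvPolynomial (Fin (n + 1)) K) * w) := by
    intro j
    rw [Phi_tmul]
    simp only [skipAt_eq]; rfl
  have e3 : (∑ j : Fin (a + 1), ((-1 : K) ^ (j : ℕ)) •
      (Phi K n a (b + 2) ((wedge K a fun i => s (skipAt j i)) ⊗ₜ[K] mulSW K (s j) w))) v =
      ∑ j : Fin (a + 1), ((-1 : K) ^ (j : ℕ)) • Matrix.det (.of fun i' j' => theta K n (v j') (s (j.succAbove i'))) •
        ((s j : MvPolynomial (Fin (n + 1)) K) * w) := by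
    rw [← AlternatingMap.coe_multilinearMap, ← AlternatingMap.toMultilinearMapLM_apply (S := K), map_sum,
      sum_apply]
    exact Finset.sum_congr rfl fun j _ => by rw [← e2]; rfl
  refine Eq.trans ?_ (congrArg ((2 : K) • ·) e3.symm)
  simp only [Finset.sum_smul, Finset.mul_sum, Finset.smul_sum]
  rw [Finset.sum_comm]
  refine Finset.sum_congr rfl fun j _ => ?_
  have h := theta_sum_val (s j)
  rw [smul_comm (2 : K), smul_comm (2 : K), ← smul_mul_assoc, ← h, Finset.sum_mul, Finset.smul_sum,
    Finset.smul_sum]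
  refine Finset.sum_congr rfl fun q _ => ?_
  simp only [smul_eq_C_mul, map_mul]
  ring

/-- projection to a homogeneous component -/
noncomputable def proj (K : Type*) [Field K] (n b : ℕ) :
    MvPolynomial (Fin (n + 1)) K →ₗ[K] S K n b :=
  (homogeneousComponent b).codRestrict (S K n b) fun f => homogeneousComponent_mem b f

theorem proj_of {b : ℕ} {f : MvPolynomial (Fin (n + 1)) K} (hf : f.IsHomogeneous b) :
    (proj K n b f : MvPolynomial (Fin (n + 1)) K) = f := by
  change homogeneousComponent b f = f
  rw [homogeneousComponent_of_mem hf, if_pos rfl]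

theorem proj_coe {b : ℕ} (w : S K n b) : proj K n b (w : MvPolynomial (Fin (n + 1)) K) = w :=
  Subtype.ext (proj_of w.2)

/-- map from the model -/
noncomputable def Psi (K : Type*) [Field K] (n a b : ℕ) :
    T K (Fin (n + 1)) a →ₗ[K] ((⋀[K]^a (S K n 2)) ⊗[K] (S K n b)) where
  toFun G := ∑ p : Fin a → Fin (n + 1) × Fin (n + 1),
    (wedge K a fun r => xx K (p r)) ⊗ₜ[K] proj K n b (gg G p)
  map_add' G H := by
    rw [← Finset.sum_add_distrib]
    refine Finset.sum_congr rfl fun p _ => ?_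
    have e : gg (G + H) p = gg G p + gg H p := rfl
    rw [e, map_add, tmul_add]
  map_smul' c G := by
    rw [RingHom.id_apply, Finset.smul_sum]
    refine Finset.sum_congr rfl fun p _ => ?_
    have e : gg (c • G) p = c • gg G p := rfl
    rw [e, map_smul]
    exact tmul_smul _ _ _

theorem Psi_apply {a b : ℕ} (G : T K (Fin (n + 1)) a) :
    Psi K n a b G = ∑ p : Fin a → Fin (n + 1) × Fin (n + 1),
    (wedge K a fun r => xx K (p r)) ⊗ₜ[K] proj K n b (gg G p) := rfl

theorem sum_insertNth' {M : Type*} [AddCommMonoid M] {ι : Type*} [Fintype ι] [DecidableEq ι]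
    {a : ℕ} (r : Fin (a + 1)) (f : (Fin (a + 1) → ι × ι) → M) :
    ∑ p, f p = ∑ p : Fin a → ι × ι, ∑ q, f (r.insertNth (α := fun _ => ι × ι) q p) := by
  rw [Finset.sum_comm, ← Fintype.sum_prod_type']
  exact (Fintype.sum_equiv (Fin.insertNthEquiv (fun _ => ι × ι) r) _ _ fun x => rfl).symm

theorem delta_Psi {a b : ℕ} {δ} (hδ : IsKoszulMap K n 2 (a + 1) b δ)
    (G : T K (Fin (n + 1)) (a + 1)) (hG : ∀ p, (gg G p).IsHomogeneous b) :
    δ (Psi K n (a + 1) b G) = ((a + 1 : ℕ) : K) • Psi K n a (b + 2) (dd a G) := by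
  rw [Psi_apply, map_sum]
  simp only [hδ _ _]
  rw [Finset.sum_comm]
  have key : ∀ j : Fin (a + 1), (∑ p : Fin (a + 1) → Fin (n + 1) × Fin (n + 1),
      ((-1 : K) ^ (j : ℕ)) • ((wedge K a fun i => xx K (p (skipAt j i))) ⊗ₜ[K]
        mulSW K (xx K (p j)) (proj K n b (gg G p)))) = Psi K n a (b + 2) (dd a G) := by
    intro j
    rw [sum_insertNth' j, Psi_apply]
    refine Finset.sum_congr rfl fun p _ => ?_
    have e : proj K n (b + 2) (gg (dd a G) p) = ∑ q : Fin (n + 1) × Fin (n + 1),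
        mulSW K (xx K q) (proj K n b (gg G (Matrix.vecCons q p))) := by
      apply Subtype.ext
      rw [proj_of (dd_homog G hG p), gg_dd, Submodule.coe_sum]
      refine Finset.sum_congr rfl fun q _ => ?_
      simp only [mulSW, xx, proj_of (hG _)]
    rw [e, tmul_sum]
    refine Finset.sum_congr rfl fun q _ => ?_
    have e2 : mulSW K (xx K q) (proj K n b (gg G (j.insertNth (α := fun _ => Fin (n + 1) × Fin (n + 1)) q p))) =
        ((-1 : K) ^ (j : ℕ)) • mulSW K (xx K q) (proj K n b (gg G (Matrix.vecCons q p))) := by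
      apply Subtype.ext
      simp only [mulSW, xx, proj_of (hG _), Submodule.coe_smul]
      rw [gg_insertNth, mul_smul_comm]
      rcases neg_one_pow_eq_or ℤ (j : ℕ) with h | h <;> rcases Nat.even_or_odd (j : ℕ) with h' | h' <;>
        simp [h'.neg_one_pow]
    simp only [skipAt_eq, Fin.insertNth_apply_same, Fin.insertNth_apply_succAbove]
    rw [e2, tmul_smul, smul_smul, ← mul_pow]
    simp
  refine (Finset.sum_congr rfl fun j _ => key j).trans ?_
  rw [Finset.sum_const, Finset.card_univ, Fintype.card_fin, Nat.cast_smul_eq_nsmul]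

theorem Psi_Phi {a b : ℕ} (z) :
    Psi K n a b (Phi K n a b z) = ((2 : K) ^ a * (a.factorial : K)) • z := by
  refine gen_induction (P := fun z => Psi K n a b (Phi K n a b z) =
    ((2 : K) ^ a * (a.factorial : K)) • z) (by simp) (fun x y hx hy => ?_) (fun s w => ?_) z
  · simp only [map_add, hx, hy, smul_add]
  rw [Psi_apply]
  simp only [gg, Phi_tmul, map_smul, proj_coe, tmul_smul]
  have e : ∀ σ : Equiv.Perm (Fin a), ∑ p : Fin a → Fin (n + 1) × Fin (n + 1),
      (∏ i, theta K n (ev K (p i)) (s (σ i))) • (wedge K a fun r => xx K (p r)) =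
      (2 : K) ^ a • Equiv.Perm.sign σ • wedge K a s := by
    intro σ
    have h1 : ιMulti K a (fun i => ∑ q, theta K n (ev K q) (s (σ i)) • xx K q) =
        ∑ p : Fin a → Fin (n + 1) × Fin (n + 1),
          (∏ i, theta K n (ev K (p i)) (s (σ i))) • ιMulti K a fun r => xx K (p r) := by
      change (ιMulti K a).toMultilinearMap _ = _
      rw [MultilinearMap.map_sum]
      exact Finset.sum_congr rfl fun p _ => MultilinearMap.map_smul_univ _ _ _
    simp only [wedge_eq]
    rw [← h1]
    simp only [theta_sum]
    have h2 : ιMulti K a (fun i => (2 : K) • s (σ i)) = (∏ _i : Fin a, (2 : K)) • ιMulti K a (s ∘ σ) :=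
      MultilinearMap.map_smul_univ (ιMulti K a).toMultilinearMap _ _
    rw [h2, AlternatingMap.map_perm]
    simp
  have f : ∑ p : Fin a → Fin (n + 1) × Fin (n + 1),
      Matrix.det (.of fun i j => theta K n (ev K (p j)) (s i)) • (wedge K a fun r => xx K (p r)) =
      ((2 : K) ^ a * (a.factorial : K)) • wedge K a s := by
    simp only [Matrix.det_apply, Matrix.of_apply, Finset.sum_smul]
    rw [Finset.sum_comm]
    simp only [smul_assoc, ← Finset.smul_sum, e]
    have : ∀ σ : Equiv.Perm (Fin a), Equiv.Perm.sign σ • (2 : K) ^ a • Equiv.Perm.sign σ • wedge K a s =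
        (2 : K) ^ a • wedge K a s := by
      intro σ
      rcases Int.units_eq_one_or (Equiv.Perm.sign σ) with h | h <;> simp [h]
    simp only [this]
    rw [Finset.sum_const, Finset.card_univ, Fintype.card_perm, Fintype.card_fin, mul_smul, 
      smul_comm, Nat.cast_smul_eq_nsmul]
  rw [smul_tmul', ← f, sum_tmul]
  rfl

theorem exact_aux [CharZero K] {a b : ℕ} (hab : 2 * (a + 1) < (b + 2) * (b + 1)) {δ₁ δ₂}
    (h₁ : IsKoszulMap K n 2 (a + 1) (b + 2) δ₁) (h₂ : IsKoszulMap K n 2 (a + 1 + 1) b δ₂) :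
    LinearMap.ker δ₁ = LinearMap.range δ₂ := by
  have two : (2 : K) ≠ 0 := two_ne_zero
  have hc : ∀ m : ℕ, ((2 : K) ^ m * (m.factorial : K)) ≠ 0 := fun m =>
    mul_ne_zero (pow_ne_zero _ two) (Nat.cast_ne_zero.2 m.factorial_ne_zero)
  have hn : ((a + 1 + 1 : ℕ) : K) ≠ 0 := Nat.cast_ne_zero.2 (by omega)
  apply le_antisymm
  · intro z hz
    have hz : δ₁ z = 0 := hz
    have h : dd a (Phi K n (a + 1) (b + 2) z) = 0 := by
      rw [Phi_delta h₁, hz]; simp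
    obtain ⟨H, hH, e⟩ := model_exact hab _ (Phi_homog z) h
    have k := delta_Psi h₂ H hH
    rw [e, Psi_Phi] at k
    have : z ∈ LinearMap.range δ₂ := by
      rw [← Submodule.smul_mem_iff _ (hc (a + 1)), ← Submodule.smul_mem_iff _ hn]
      exact ⟨_, k⟩
    exact this
  · rintro _ ⟨y, rfl⟩
    change δ₁ (δ₂ y) = 0
    have k := delta_Psi h₂ _ (Phi_homog y)
    rw [Psi_Phi, map_smul] at k
    have k2 := delta_Psi h₁ _ (dd_homog _ (Phi_homog y))
    rw [dd_dd, map_zero, smul_zero] at k2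
    have k3 := congrArg δ₁ k
    rw [map_smul] at k3
    have k4 : δ₁ (((a + 1 + 1 : ℕ) : K) • Psi K n (a + 1) (b + 2) (dd (a + 1) (Phi K n (a + 1 + 1) b y))) = 0 := by
      rw [map_smul, k2, smul_zero]
    exact (smul_eq_zero.1 (k3.trans k4)).resolve_left (hc _)

theorem exact_cast [CharZero K] {a b c : ℕ} (hab : 2 * (a + 1) < (b + 2) * (b + 1))
    (h : b + 2 = c) {δ₁ δ₂}
    (h₁ : IsKoszulMap K n 2 (a + 1) c δ₁) (h₂ : IsKoszulMap K n 2 (a + 1 + 1) b δ₂) :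
    LinearMap.ker δ₁ = LinearMap.range
        ((TensorProduct.congr (LinearEquiv.refl K (⋀[K]^(a + 1) (S K n 2)))
            (scast K h)).toLinearMap ∘ₗ δ₂) := by
  subst h
  rw [exact_aux hab h₁ h₂]
  have : (TensorProduct.congr (LinearEquiv.refl K (⋀[K]^(a + 1) (S K n 2)))
            (scast K (n := n) (rfl : b + 2 = b + 2))).toLinearMap = LinearMap.id := by
    ext x y; rfl
  rw [this]; rfl

end Transport
end VK

/-- for `n ≥ 3`, `d = 2`, the Veronese–Koszul complex at `(i,q)` is exact for all
`1 ≤ i ≤ 5` and `q ≥ 2` (the quadratic Veronese embedding satisfies `N_5`). -/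
theorem stmt14 (K : Type*) [Field K] [CharZero K] (n : ℕ) (hn : 3 ≤ n) :
    ∀ i, 1 ≤ i → i ≤ 5 → ∀ q, 2 ≤ q → VKExact K n 2 i q := by
  intro i hi hi5 q hq h δ₁ δ₂ h₁ h₂
  obtain ⟨a, rfl⟩ : ∃ a, i = a + 1 := ⟨i - 1, by omega⟩
  refine VK.exact_cast ?_ h h₁ h₂
  have : 2 ≤ (q - 1) * 2 := by omega
  nlinarith
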